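/- There exists a finite simple graph that is a trapezoid graph but is not a pairwise compatibility graph (PCG). (Corollary 2, trapezoid case.) -/

import Mathlib

/-- `G` is a pairwise compatibility graph: there are a finite tree `T` with nonnegative
edge weights, an injection of the vertices of `G` into the leaves of `T`, and bounds
`0 ≤ dmin ≤ dmax` such that two distinct vertices are adjacent iff the weighted
tree-distance of the corresponding leaves lies in `[dmin, dmax]`. -/
def IsPCG {V : Type} [Fintype V] (G : SimpleGraph V) : Prop :=
  ∃ (n : ℕ) (T : SimpleGraph (Fin n)) (w : Sym2 (Fin n) → ℝ)
      (f : V → Fin n) (dmin dmax : ℝ),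
    T.Connected ∧ T.IsAcyclic ∧
    (∀ e ∈ T.edgeSet, 0 ≤ w e) ∧
    Function.Injective f ∧
    (∀ v : V, ∃! x : Fin n, T.Adj (f v) x) ∧
    0 ≤ dmin ∧ dmin ≤ dmax ∧
    ∀ u v : V, u ≠ v →
      (G.Adj u v ↔ ∃ p : T.Walk (f u) (f v), p.IsPath ∧
        dmin ≤ (p.edges.map w).sum ∧ (p.edges.map w).sum ≤ dmax)

/-- `G` is a trapezoid graph: vertices are represented by trapezoids between the lines
`y = 0` and `y = 1` (the convex hull of `(a,0), (b,0), (c,1), (d,1)` with `a ≤ b`,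
`c ≤ d`), and two distinct vertices are adjacent iff their trapezoids intersect. -/
def IsTrapezoidGraph {V : Type} [Fintype V] (G : SimpleGraph V) : Prop :=
  ∃ a b c d : V → ℝ,
    (∀ v, a v ≤ b v) ∧ (∀ v, c v ≤ d v) ∧
    ∀ u v : V, u ≠ v →
      (G.Adj u v ↔
        ((convexHull ℝ {(a u, 0), (b u, 0), (c u, 1), (d u, 1)} : Set (ℝ × ℝ)) ∩
          (convexHull ℝ {(a v, 0), (b v, 0), (c v, 1), (d v, 1)} : Set (ℝ × ℝ))).Nonempty)

namespace PCGAux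

open SimpleGraph

section Tree

variable {V : Type} {T : SimpleGraph V} {w : Sym2 V → ℝ}

/-- weight of a walk -/
def wt (w : Sym2 V → ℝ) {u v : V} (p : T.Walk u v) : ℝ := (p.edges.map w).sum

lemma wt_append {a b c : V} (p : T.Walk a b) (q : T.Walk b c) :
    wt w (p.append q) = wt w p + wt w q := by
  simp [wt, Walk.edges_append]

lemma wt_reverse {a b : V} (p : T.Walk a b) : wt w p.reverse = wt w p := by
  simp [wt, Walk.edges_reverse, List.sum_reverse]

lemma wt_nonneg (hw : ∀ e ∈ T.edgeSet, 0 ≤ w e) {a b : V} (p : T.Walk a b) : 0 ≤ wt w p := by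
  unfold wt
  apply List.sum_nonneg
  intro x hx
  obtain ⟨e, he, rfl⟩ := List.mem_map.1 hx
  exact hw e (p.edges_subset_edgeSet he)

/-- first hitting point of a path -/
lemma first_hit [DecidableEq V] (S : V → Prop) {c a : V} (q : T.Walk c a) (ha : S a) :
    ∃ m, S m ∧ ∃ r : T.Walk c m, r.IsPath ∧ ∀ x ∈ r.support, S x → x = m := by
  induction q with
  | nil => exact ⟨_, ha, Walk.nil, by simp, by simp⟩
  | @cons c x a h q ih =>
    by_cases hc : S c
    · exact ⟨_, hc, Walk.nil, by simp, by simp⟩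
    · obtain ⟨m, hm, r, hr, hr'⟩ := ih ha
      refine ⟨m, hm, (Walk.cons h r).bypass, Walk.bypass_isPath _, ?_⟩
      intro y hy hSy
      have := Walk.support_bypass_subset _ hy
      rw [Walk.support_cons, List.mem_cons] at this
      rcases this with rfl | h'
      · exact absurd hSy hc
      · exact hr' y h' hSy

lemma append_isPath {a b c : V} {p : T.Walk a b} {q : T.Walk b c} (hp : p.IsPath) (hq : q.IsPath)
    (h : ∀ x ∈ p.support, x ∈ q.support → x = b) : (p.append q).IsPath := by
  rw [Walk.isPath_def, Walk.support_append, List.nodup_append]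
  refine ⟨hp.support_nodup, hq.support_nodup.sublist (List.tail_sublist _), ?_⟩
  rintro x hx y hy rfl
  have hxb := h x hx (List.mem_of_mem_tail hy)
  subst hxb
  have := hq.support_nodup
  rw [Walk.support_eq_cons, List.nodup_cons] at this
  exact this.1 hy

/-- A distance function measuring paths satisfies the four point condition. -/
lemma four_point (hc : T.Connected) (hw : ∀ e ∈ T.edgeSet, 0 ≤ w e)
    (D : V → V → ℝ) (hD : ∀ u v (p : T.Walk u v), p.IsPath → wt w p = D u v) (a b c d : V) :
    D a b + D c d ≤ D a c + D b d ∨ D a b + D c d ≤ D a d + D b c := by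
  classical
  have hpath : ∀ u v, ∃ p : T.Walk u v, p.IsPath := fun u v => by
    obtain ⟨p⟩ := hc.preconnected u v
    exact ⟨p.bypass, p.bypass_isPath⟩
  have hnn : ∀ u v, 0 ≤ D u v := fun u v => by
    obtain ⟨p, hp⟩ := hpath u v
    rw [← hD u v p hp]; exact wt_nonneg hw p
  have hsymm : ∀ u v, D u v = D v u := fun u v => by
    obtain ⟨p, hp⟩ := hpath u v
    rw [← hD u v p hp, ← hD v u p.reverse hp.reverse, wt_reverse]
  have happ : ∀ u v x (p : T.Walk u v) (q : T.Walk v x), (p.append q).IsPath →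
      D u x = D u v + D v x := fun u v x p q h => by
    rw [← hD u x _ h, wt_append, hD u v p h.of_append_left, hD v x q h.of_append_right]
  have hsplit : ∀ u v x (p : T.Walk u v), p.IsPath → x ∈ p.support →
      D u v = D u x + D x v := fun u v x p hp hx => by
    apply happ u x v (p.takeUntil x hx) (p.dropUntil x hx)
    rwa [Walk.take_spec]
  have hmed : ∀ a b c (P : T.Walk a b), P.IsPath → ∃ m ∈ P.support,
      D c a = D c m + D m a ∧ D c b = D c m + D m b := fun a b c P hP => by
    obtain ⟨q, -⟩ := hpath c a
    obtain ⟨m, hm, r, hr, hr'⟩ := first_hit (fun x => x ∈ P.support) q P.start_mem_support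
    refine ⟨m, hm, ?_, ?_⟩
    · apply happ c m a r (P.takeUntil m hm).reverse
      apply append_isPath hr (hP.takeUntil hm).reverse
      intro x hx hx'
      rw [Walk.support_reverse, List.mem_reverse] at hx'
      exact hr' x hx (P.support_takeUntil_subset_support hm hx')
    · apply happ c m b r (P.dropUntil m hm)
      apply append_isPath hr (hP.dropUntil hm)
      intro x hx hx'
      exact hr' x hx (P.support_dropUntil_subset_support hm hx')
  have htri : ∀ a b c, D a b ≤ D a c + D c b := fun a b c => by
    obtain ⟨P, hP⟩ := hpath a b
    obtain ⟨m, hm, h1, h2⟩ := hmed a b c P hP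
    have := hsplit a b m P hP hm
    linarith [hnn c m, hsymm a c, hsymm a m]
  obtain ⟨P, hP⟩ := hpath a b
  obtain ⟨m, hm, h1, h2⟩ := hmed a b c P hP
  obtain ⟨m', hm', h1', h2'⟩ := hmed a b d P hP
  have e1 := hsplit a b m P hP hm
  have e2 := hsplit a b m' P hP hm'
  have t1 := htri c d m
  have t2 := htri m d m'
  have s1 := hsymm a c
  have s2 := hsymm a d
  have s3 := hsymm b c
  have s4 := hsymm b d
  have s5 := hsymm a m
  have s6 := hsymm a m'
  have s7 := hsymm d m'
  have s8 := hsymm m m'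
  have hm2 := hm'
  rw [← Walk.take_spec P hm, Walk.mem_support_append_iff] at hm2
  rcases hm2 with h | h
  · have e3 := hsplit a m m' _ (hP.takeUntil hm) h
    left; linarith
  · have e3 := hsplit m b m' _ (hP.dropUntil hm) h
    right; linarith

end Tree

/-- Join of two copies of `2K₂`. -/
def G8 : SimpleGraph (Fin 8) where
  Adj u v := u ≠ v ∧ ¬ (u.val / 4 = v.val / 4 ∧ u.val / 2 ≠ v.val / 2)
  symm := ⟨by
    rintro u v ⟨h1, h2⟩
    exact ⟨h1.symm, fun h => h2 ⟨h.1.symm, h.2.symm⟩⟩⟩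
  loopless := ⟨fun u h => h.1 rfl⟩

instance : DecidableRel G8.Adj := fun u v => by unfold G8; infer_instance

lemma not_pcg : ¬ IsPCG G8 := by
  rintro ⟨n, T, w, f, lo, hi, hc, hac, hw, -, -, -, -, hadj⟩
  have hpath : ∀ u v, ∃ p : T.Walk u v, p.IsPath := fun u v => by
    classical
    obtain ⟨p⟩ := hc.preconnected u v
    exact ⟨p.bypass, p.bypass_isPath⟩
  choose P hP using hpath
  have huniq : ∀ u v (p : T.Walk u v), p.IsPath → p = P u v := fun u v p hp => by
    have := hac.path_unique ⟨p, hp⟩ ⟨P u v, hP u v⟩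
    exact congrArg Subtype.val this
  have h4 := four_point hc hw (fun u v => wt w (P u v))
    (fun u v p hp => by rw [huniq u v p hp])
  obtain ⟨e, he⟩ : ∃ e : Fin 8 → Fin 8 → ℝ, e = fun i j => wt w (P (f i) (f j)) := ⟨_, rfl⟩
  have h4e : ∀ i j k l, e i j + e k l ≤ e i k + e j l ∨ e i j + e k l ≤ e i l + e j k := by
    intro i j k l
    rw [he]; exact h4 _ _ _ _
  have hA : ∀ i j, i ≠ j → (G8.Adj i j ↔ lo ≤ e i j ∧ e i j ≤ hi) := by
    intro i j hij
    rw [hadj i j hij, he]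
    constructor
    · rintro ⟨p, hp, h1, h2⟩
      rw [huniq _ _ p hp] at h1 h2
      exact ⟨h1, h2⟩
    · rintro ⟨h1, h2⟩
      exact ⟨_, hP _ _, h1, h2⟩
  have hadj' : ∀ i j, G8.Adj i j → lo ≤ e i j ∧ e i j ≤ hi := fun i j h => (hA i j h.ne).1 h
  have hblue : ∀ i j k l, G8.Adj i k → G8.Adj j l → G8.Adj i l → G8.Adj j k →
      hi < e i j → hi < e k l → False := by
    intro i j k l a1 a2 a3 a4 h1 h2
    have := hadj' _ _ a1
    have := hadj' _ _ a2
    have := hadj' _ _ a3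
    have := hadj' _ _ a4
    rcases h4e i j k l with h | h <;> linarith
  have hred : ∀ i j k l, G8.Adj i j → G8.Adj k l →
      i ≠ k → j ≠ l → i ≠ l → j ≠ k →
      ¬ G8.Adj i k → ¬ G8.Adj j l → ¬ G8.Adj i l → ¬ G8.Adj j k →
      hi < e i k ∨ hi < e j l ∨ hi < e i l ∨ hi < e j k := by
    intro i j k l a1 a2 n1 n2 n3 n4 b1 b2 b3 b4
    rw [hA _ _ n1] at b1
    rw [hA _ _ n2] at b2
    rw [hA _ _ n3] at b3
    rw [hA _ _ n4] at b4
    have := hadj' _ _ a1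
    have := hadj' _ _ a2
    by_contra! hcon
    obtain ⟨c1, c2, c3, c4⟩ := hcon
    have d1 : e i k < lo := by by_contra! h; exact b1 ⟨h, c1⟩
    have d2 : e j l < lo := by by_contra! h; exact b2 ⟨h, c2⟩
    have d3 : e i l < lo := by by_contra! h; exact b3 ⟨h, c3⟩
    have d4 : e j k < lo := by by_contra! h; exact b4 ⟨h, c4⟩
    rcases h4e i j k l with h | h <;> linarith
  have r1 := hred 0 1 2 3 (by decide) (by decide) (by decide) (by decide) (by decide) (by decide)
    (by decide) (by decide) (by decide) (by decide)
  have r2 := hred 4 5 6 7 (by decide) (by decide) (by decide) (by decide) (by decide) (by decide)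
    (by decide) (by decide) (by decide) (by decide)
  rcases r1 with h1 | h1 | h1 | h1 <;> rcases r2 with h2 | h2 | h2 | h2 <;>
    exact hblue _ _ _ _ (by decide) (by decide) (by decide) (by decide) h1 h2

lemma mem_hull (p q : ℝ) (z : ℝ × ℝ) :
    z ∈ (convexHull ℝ {(p, 0), (p, 0), (q, 1), (q, 1)} : Set (ℝ × ℝ)) ↔
      0 ≤ z.2 ∧ z.2 ≤ 1 ∧ z.1 = p + (q - p) * z.2 := by
  have : ({(p, 0), (p, 0), (q, 1), (q, 1)} : Set (ℝ × ℝ)) = {(p, 0), (q, 1)} := by simp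
  rw [this, convexHull_pair]
  constructor
  · rintro ⟨s, t, hs, ht, hst, rfl⟩
    refine ⟨by simpa using ht, by simp; linarith, ?_⟩
    have : s = 1 - t := by linarith
    subst this
    simp; ring
  · rintro ⟨h0, h1, h⟩
    refine ⟨1 - z.2, z.2, by linarith, h0, by ring, ?_⟩
    ext
    · simp [h]; ring
    · simp

/-- bottom endpoints -/
def bot (v : Fin 8) : ℝ := ![0, 0, 1, 1, 2, 2, 3, 3] v
/-- top endpoints -/
def top (v : Fin 8) : ℝ := ![2, 2, 3, 3, 0, 0, 1, 1] v

lemma trapezoid : IsTrapezoidGraph G8 := by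
  refine ⟨bot, bot, top, top, fun _ => le_rfl, fun _ => le_rfl, ?_⟩
  intro u v huv
  have key : ((convexHull ℝ {(bot u, 0), (bot u, 0), (top u, 1), (top u, 1)} : Set (ℝ × ℝ)) ∩
      (convexHull ℝ {(bot v, 0), (bot v, 0), (top v, 1), (top v, 1)} : Set (ℝ × ℝ))).Nonempty ↔
      ∃ y : ℝ, 0 ≤ y ∧ y ≤ 1 ∧ bot u + (top u - bot u) * y = bot v + (top v - bot v) * y := by
    constructor
    · rintro ⟨z, h1, h2⟩
      rw [mem_hull] at h1 h2
      exact ⟨z.2, h1.1, h1.2.1, h1.2.2.symm.trans h2.2.2⟩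
    · rintro ⟨y, h0, h1, h⟩
      exact ⟨(bot u + (top u - bot u) * y, y), (mem_hull _ _ _).2 ⟨h0, h1, rfl⟩,
        (mem_hull _ _ _).2 ⟨h0, h1, h⟩⟩
  rw [key]
  by_cases hadj : G8.Adj u v
  · refine ⟨fun _ => ?_, fun _ => hadj⟩
    refine ⟨|bot u - bot v| / 4, ?_⟩
    fin_cases u <;> fin_cases v <;>
      first
        | exact absurd hadj (by decide)
        | (simp [bot, top] <;> norm_num [abs_of_pos, abs_of_neg])
  · refine ⟨fun h => absurd h hadj, ?_⟩
    rintro ⟨y, h0, h1, h⟩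
    exfalso
    fin_cases u <;> fin_cases v <;>
      first
        | exact hadj (by decide)
        | exact huv rfl
        | (simp [bot, top] at h <;> linarith)

end PCGAux

/-- There exists a finite simple graph that is a trapezoid graph but is not a
pairwise compatibility graph. -/
theorem exists_TrapezoidGraph_not_PCG :
    ∃ (n : ℕ) (G : SimpleGraph (Fin n)), IsTrapezoidGraph G ∧ ¬ IsPCG G :=
  ⟨8, PCGAux.G8, PCGAux.trapezoid, PCGAux.not_pcg⟩
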